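/- arXiv:2001.06663 — 2 statements merged into one kernel-verified Lean document; each statement's English description precedes it below -/
import Mathlib

section
/- For every a ∈ ℂ and all reals y₁ > y₂ > 0, there exists a constant C₃ > 0 such that ζ̃(s) ≠ a for every s = σ + it with −y₁ ≤ σ ≤ −y₂ and |t| > C₃. -/
open Finset Filter Asymptotics

/-- The symmetric sum of Euler-Zagier multiple zeta functions, via Hoffman's formula:
`ζ̃(s) = Σ_P (−1)^{r−#P} Π_{p ∈ P} (#p − 1)! ζ((Σ_{j∈p} a_j) s)`, where `P` runs over
unordered set partitions of `{0, …, r−1}` into nonempty blocks. -/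
noncomputable def tzeta {r : ℕ} (a : Fin r → ℝ) (s : ℂ) : ℂ :=
  ∑ P ∈ (Finset.univ : Finset (Finset (Fin r))).powerset.filter
      (fun P => (∅ : Finset (Fin r)) ∉ P ∧ P.sup id = Finset.univ ∧
        ∀ p ∈ P, ∀ q ∈ P, p ≠ q → Disjoint p q),
    (-1 : ℂ) ^ (r - P.card) *
      ∏ p ∈ P, (((p.card - 1).factorial : ℂ) *
        riemannZeta ((∑ j ∈ p, (a j : ℂ)) * s))

/-- On the critical line `|Γ(1/2 + it)|² = π / cosh (π t) ≤ 2 π e^{-π|t|}`. -/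
theorem Complex.norm_Gamma_le_of_re_eq_half {s : ℂ} (hs : s.re = 1 / 2) :
    ‖Complex.Gamma s‖ ≤ √(2 * Real.pi) * Real.exp (-(Real.pi / 2 * |s.im|)) := by
  have hconj : 1 - s = (starRingEnd ℂ) s := by
    apply Complex.ext <;> (simp [hs]; try norm_num)
  have h := Complex.Gamma_mul_Gamma_one_sub s
  rw [hconj, Complex.Gamma_conj, Complex.mul_conj, Complex.normSq_eq_norm_sq] at h
  have hsin : Complex.sin (Real.pi * s) = (Real.cosh (Real.pi * s.im) : ℝ) := by
    have : (Real.pi : ℂ) * s = (Real.pi * s.im : ℝ) * Complex.I + Real.pi / 2 := by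
      apply Complex.ext <;> simp [hs]; ring
    rw [this, Complex.sin_add_pi_div_two, Complex.cos_mul_I, Complex.ofReal_cosh]
  rw [hsin] at h
  have h' : ‖Complex.Gamma s‖ ^ 2 = Real.pi / Real.cosh (Real.pi * s.im) := by
    exact_mod_cast h
  have hcosh : Real.exp (Real.pi * |s.im|) ≤ 2 * Real.cosh (Real.pi * s.im) := by
    rw [← Real.cosh_abs, abs_mul, abs_of_pos Real.pi_pos, Real.cosh_eq]
    have := Real.exp_pos (-(Real.pi * |s.im|))
    linarith
  refine (sq_le_sq₀ (norm_nonneg _) (by positivity)).1 ?_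
  rw [h', mul_pow, Real.sq_sqrt (by positivity), ← Real.exp_nat_mul, div_le_iff₀ (Real.cosh_pos _)]
  have he : Real.exp (((2 : ℕ) : ℝ) * -(Real.pi / 2 * |s.im|)) * Real.exp (Real.pi * |s.im|) = 1 := by
    rw [← Real.exp_add, Real.exp_eq_one_iff]; push_cast; ring
  have h1 := mul_le_mul_of_nonneg_left hcosh
    (Real.exp_pos (((2 : ℕ) : ℝ) * -(Real.pi / 2 * |s.im|))).le
  rw [he] at h1
  nlinarith [Real.pi_pos]

theorem Complex.norm_Gamma_le_Gamma_re {s : ℂ} (hs : 0 < s.re) :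
    ‖Complex.Gamma s‖ ≤ Real.Gamma s.re := by
  rw [Complex.Gamma_eq_integral hs, Complex.GammaIntegral, Real.Gamma_eq_integral hs]
  refine (MeasureTheory.norm_integral_le_integral_norm _).trans (le_of_eq ?_)
  refine MeasureTheory.setIntegral_congr_fun measurableSet_Ioi fun x hx => ?_
  simp only [norm_mul]
  rw [Complex.norm_cpow_eq_rpow_re_of_pos hx, Complex.norm_real, Real.norm_of_nonneg (by positivity)]
  simp

theorem Complex.arg_mul_im_le {s : ℂ} (hs : 0 ≤ s.re) :
    s.arg * s.im ≤ Real.pi / 2 * |s.im| := by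
  refine (le_abs_self _).trans ?_
  rw [abs_mul]
  exact mul_le_mul_of_nonneg_right (Complex.abs_arg_le_pi_div_two_iff.2 hs) (abs_nonneg _)

theorem Complex.le_arg_mul_im {s : ℂ} (hs : 0 < s.re) :
    Real.pi / 2 * |s.im| - s.re ≤ s.arg * s.im := by
  have h0 := Complex.abs_arg_lt_pi_div_two_iff.2 (Or.inl hs)
  rw [abs_lt] at h0
  rcases lt_trichotomy s.im 0 with ht | ht | ht
  · have harg : s.arg < 0 := Complex.arg_neg_iff.2 ht
    have h := Real.le_tan (x := Real.pi / 2 - -s.arg) (by linarith) (by linarith)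
    rw [Real.tan_pi_div_two_sub, Real.tan_neg, Complex.tan_arg, ← neg_div, inv_div,
      le_div_iff₀ (by linarith)] at h
    rw [abs_of_neg ht]
    linarith
  · simp [ht, hs.le]
  · have harg : 0 < s.arg := by
      rcases (Complex.arg_nonneg_iff.2 ht.le).lt_or_eq with h | h
      · exact h
      · exact absurd (Complex.arg_eq_zero_iff.1 h.symm).2 ht.ne'
    have h := Real.le_tan (x := Real.pi / 2 - s.arg) (by linarith) (by linarith)
    rw [Real.tan_pi_div_two_sub, Complex.tan_arg, inv_div, le_div_iff₀ ht] at h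
    rw [abs_of_pos ht]
    linarith

theorem Complex.Gamma_add_natCast {s : ℂ} (n : ℕ) (hs : ∀ k < n, s + k ≠ 0) :
    Complex.Gamma (s + n) = (∏ k ∈ range n, (s + k)) * Complex.Gamma s := by
  induction n with
  | zero => simp
  | succ n ih =>
    rw [Finset.prod_range_succ, Nat.cast_succ, ← add_assoc, Complex.Gamma_add_one _ (hs n n.lt_succ_self),
      ih fun k hk => hs k (hk.trans n.lt_succ_self)]
    ring

/-- Phragmén-Lindelöf applied to `Γ(s) / s ^ (s - 1/2)`. -/
theorem Complex.norm_Gamma_le_rpow_mul_exp_arg (n : ℕ) {s : ℂ} (h1 : 1 / 2 ≤ s.re)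
    (h2 : s.re ≤ n + 1 / 2) :
    ‖Complex.Gamma s‖ ≤
      √(2 * Real.pi) * (‖s‖ ^ (s.re - 1 / 2) / Real.exp (s.arg * s.im)) := by
  rcases Nat.eq_zero_or_pos n with rfl | hn
  · have hre : s.re = 1 / 2 := le_antisymm (by simpa using h2) h1
    refine (Complex.norm_Gamma_le_of_re_eq_half hre).trans ?_
    rw [hre, sub_self, Real.rpow_zero, one_div, ← Real.exp_neg]
    exact mul_le_mul_of_nonneg_left (Real.exp_le_exp.2 (neg_le_neg
      (Complex.arg_mul_im_le (by linarith)))) (Real.sqrt_nonneg _)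
  have hn' : (1 : ℝ) ≤ n := by exact_mod_cast hn
  have hnorm : ∀ z : ℂ, 1 / 2 ≤ z.re → ‖z ^ (z - 1 / 2)‖ =
      ‖z‖ ^ (z.re - 1 / 2) / Real.exp (z.arg * z.im) := by
    intro z hz
    have : z ≠ 0 := by rintro rfl; norm_num at hz
    rw [Complex.norm_cpow_of_ne_zero this]
    simp
  have hpos : ∀ z : ℂ, 1 / 2 ≤ z.re → 0 < ‖z ^ (z - 1 / 2)‖ := by
    intro z hz
    rw [hnorm z hz]
    have : 0 < ‖z‖ := lt_of_lt_of_le (by linarith) (Complex.re_le_norm z)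
    positivity
  rw [← hnorm s h1, ← div_le_iff₀ (hpos s h1), ← norm_div]
  have key : ∀ z : ℂ, 1 / 2 ≤ z.re → ∀ k : ℕ, z.re = k + 1 / 2 →
      ‖Complex.Gamma z / z ^ (z - 1 / 2)‖ ≤ √(2 * Real.pi) := by
    intro z hz k hk
    rw [norm_div, div_le_iff₀ (hpos z hz), hnorm z hz]
    have hre : (z - k).re = 1 / 2 := by simp [hk]
    have hg := Complex.Gamma_add_natCast (s := z - k) k (fun j _ h0 => by
      have := congrArg Complex.re h0
      rw [Complex.add_re, hre] at this
      simp at this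
      have : (0 : ℝ) ≤ j := j.cast_nonneg
      linarith)
    rw [sub_add_cancel] at hg
    rw [hg, norm_mul, norm_prod]
    have hprod : ∏ j ∈ range k, ‖z - k + j‖ ≤ ‖z‖ ^ (z.re - 1 / 2) := by
      have : z.re - 1 / 2 = k := by rw [hk]; ring
      rw [this, Real.rpow_natCast]
      calc ∏ j ∈ range k, ‖z - k + j‖ ≤ ∏ j ∈ range k, ‖z‖ := by
            refine Finset.prod_le_prod (fun _ _ => norm_nonneg _) fun j hj => ?_
            have hjk : (j : ℝ) < k := by exact_mod_cast Finset.mem_range.1 hj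
            rw [Complex.norm_def, Complex.norm_def]
            refine Real.sqrt_le_sqrt ?_
            rw [Complex.normSq_apply, Complex.normSq_apply]
            simp only [Complex.add_re, Complex.sub_re, Complex.natCast_re, Complex.add_im,
              Complex.sub_im, Complex.natCast_im, hk]
            have : (0 : ℝ) ≤ j := j.cast_nonneg
            nlinarith
        _ = ‖z‖ ^ k := by simp
    have hg2 := Complex.norm_Gamma_le_of_re_eq_half hre
    have him : (z - k).im = z.im := by simp
    rw [him] at hg2
    calc _ ≤ ‖z‖ ^ (z.re - 1 / 2) * (√(2 * Real.pi) * Real.exp (-(Real.pi / 2 * |z.im|))) := by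
          gcongr
      _ ≤ ‖z‖ ^ (z.re - 1 / 2) * (√(2 * Real.pi) * Real.exp (-(z.arg * z.im))) := by
          have := Real.exp_le_exp.2 (neg_le_neg (Complex.arg_mul_im_le (s := z) (by linarith)))
          gcongr
      _ = _ := by rw [Real.exp_neg]; field_simp
  have hdiff : ∀ z : ℂ, 1 / 2 ≤ z.re →
      DifferentiableAt ℂ (fun z => Complex.Gamma z / z ^ (z - 1 / 2)) z := by
    intro z hz
    refine (Complex.differentiableAt_Gamma z fun m h0 => ?_).div ?_ ?_
    · have := congrArg Complex.re h0
      simp at this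
      have : (0 : ℝ) ≤ m := m.cast_nonneg
      linarith
    · exact differentiableAt_id.cpow (by fun_prop) (Or.inl (by simp; linarith))
    · exact norm_pos_iff.1 (hpos z hz)
  refine PhragmenLindelof.vertical_strip (f := fun z => Complex.Gamma z / z ^ (z - 1 / 2))
    (a := 1 / 2) (b := n + 1 / 2) ?_ ?_ ?_ ?_ h1 h2
  · refine DifferentiableOn.diffContOnCl fun z hz => ?_
    have hz' : z ∈ Complex.re ⁻¹' (Set.Icc (1 / 2 : ℝ) (n + 1 / 2)) := by
      refine closure_minimal ?_ (isClosed_Icc.preimage Complex.continuous_re) hz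
      exact Set.preimage_mono Set.Ioo_subset_Icc_self
    exact (hdiff z hz'.1).differentiableWithinAt
  · obtain ⟨M, hM⟩ := (isCompact_Icc (a := (1 / 2 : ℝ)) (b := n + 1 / 2)).exists_bound_of_continuousOn
      (f := Real.Gamma) (fun x hx => (Real.differentiableAt_Gamma (fun m h0 => by
        have h3 : (0 : ℝ) ≤ m := m.cast_nonneg
        have := hx.1
        linarith)).continuousAt.continuousWithinAt)
    have hc : 0 < Real.pi / (n + 1 / 2 - 1 / 2) := by
      have := Real.pi_pos
      simp only [add_sub_cancel_right]; positivity
    set c := Real.pi / (n + 1 / 2 - 1 / 2) / 2 with hc_def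
    have hc2 : 0 < c := by positivity
    refine ⟨c, half_lt_self hc, Real.pi / 2 / c, ?_⟩
    refine IsBigO.of_bound (M * 2 ^ n) ?_
    refine eventually_inf_principal.2 (Eventually.of_forall fun z hz => ?_)
    have hz1 : 1 / 2 ≤ z.re := hz.1.le
    have hz2 : z.re ≤ n + 1 / 2 := hz.2.le
    rw [norm_div, div_le_iff₀ (hpos z hz1), hnorm z hz1, Real.norm_of_nonneg (Real.exp_pos _).le]
    have hMz := hM z.re ⟨hz1, hz2⟩
    have hM0 : 0 ≤ M := (norm_nonneg _).trans hMz
    have hG := (Complex.norm_Gamma_le_Gamma_re (s := z) (by linarith)).trans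
      ((le_abs_self _).trans hMz)
    have hz3 : 1 / 2 ≤ ‖z‖ := hz1.trans (Complex.re_le_norm z)
    have hpow : (1 / 2 : ℝ) ^ n ≤ ‖z‖ ^ (z.re - 1 / 2) := by
      calc (1 / 2 : ℝ) ^ n = (1 / 2 : ℝ) ^ (n : ℝ) := (Real.rpow_natCast _ _).symm
        _ ≤ (1 / 2 : ℝ) ^ (z.re - 1 / 2) :=
          Real.rpow_le_rpow_of_exponent_ge (by norm_num) (by norm_num) (by linarith)
        _ ≤ _ := Real.rpow_le_rpow (by norm_num) hz3 (by linarith)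
    have hexp : Real.exp (z.arg * z.im) ≤ Real.exp (Real.pi / 2 / c * Real.exp (c * |z.im|)) := by
      refine Real.exp_le_exp.2 ((Complex.arg_mul_im_le (by linarith)).trans ?_)
      have := Real.add_one_le_exp (c * |z.im|)
      calc Real.pi / 2 * |z.im| = Real.pi / 2 / c * (c * |z.im|) := by field_simp
        _ ≤ _ := by
          refine mul_le_mul_of_nonneg_left (by linarith) (by have := Real.pi_pos; positivity)
    calc ‖Complex.Gamma z‖ ≤ M := hG
      _ = M * 2 ^ n * Real.exp (z.arg * z.im) * ((1 / 2) ^ n / Real.exp (z.arg * z.im)) := by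
        rw [one_div, inv_pow]; field_simp
      _ ≤ _ := by gcongr
  · intro z hz
    exact key z hz.ge 0 (by simp [hz])
  · intro z hz
    exact key z (by rw [hz]; linarith) n hz

theorem Complex.norm_cos_le (z : ℂ) : ‖Complex.cos z‖ ≤ Real.exp |z.im| := by
  rw [Complex.cos, norm_div, Complex.norm_ofNat, div_le_iff₀ two_pos]
  refine (norm_add_le _ _).trans ?_
  rw [Complex.norm_exp, Complex.norm_exp]
  have h1 : (z * Complex.I).re ≤ |z.im| := by simpa using neg_le_abs z.im
  have h2 : (-z * Complex.I).re ≤ |z.im| := by simpa using le_abs_self z.im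
  linarith [Real.exp_le_exp.2 h1, Real.exp_le_exp.2 h2]

theorem Complex.exp_abs_im_le_norm_cos {z : ℂ} (hz : 1 ≤ |z.im|) :
    Real.exp |z.im| / 4 ≤ ‖Complex.cos z‖ := by
  have hexp : 2 * Real.exp (-|z.im|) ≤ Real.exp |z.im| := by
    have h1 := Real.add_one_le_exp |z.im|
    have h2 : Real.exp (-|z.im|) ≤ 1 := Real.exp_le_one_iff.2 (by linarith)
    linarith
  have hsub : Real.exp |z.im| - Real.exp (-|z.im|) ≤
      ‖Complex.exp (z * Complex.I) + Complex.exp (-z * Complex.I)‖ := by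
    have h1 : ‖Complex.exp (z * Complex.I)‖ = Real.exp (-z.im) := by simp [Complex.norm_exp]
    have h2 : ‖Complex.exp (-z * Complex.I)‖ = Real.exp z.im := by simp [Complex.norm_exp]
    rcases abs_cases z.im with ⟨h, -⟩ | ⟨h, -⟩
    · have := norm_sub_le_norm_add (Complex.exp (-z * Complex.I)) (Complex.exp (z * Complex.I))
      rwa [h1, h2, add_comm (Complex.exp _), ← h] at this
    · have := norm_sub_le_norm_add (Complex.exp (z * Complex.I)) (Complex.exp (-z * Complex.I))
      rw [h1, h2] at this
      rwa [h, neg_neg]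
  rw [Complex.cos, norm_div, Complex.norm_ofNat, le_div_iff₀ two_pos]
  linarith

/-- Upper half of Stirling's estimate for `Γ` on vertical strips. -/
theorem Complex.exists_norm_Gamma_le (n : ℕ) : ∃ C : ℝ, 0 < C ∧ ∀ s : ℂ, 1 / 2 ≤ s.re →
    s.re ≤ n + 1 / 2 → 1 ≤ |s.im| →
    ‖Complex.Gamma s‖ ≤ C * (|s.im| ^ (s.re - 1 / 2) * Real.exp (-(Real.pi / 2 * |s.im|))) := by
  refine ⟨√(2 * Real.pi) * ((n + 2) ^ n * Real.exp (n + 1 / 2)), by positivity,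
    fun s h1 h2 h3 => (Complex.norm_Gamma_le_rpow_mul_exp_arg n h1 h2).trans ?_⟩
  rw [mul_assoc]
  refine mul_le_mul_of_nonneg_left ?_ (Real.sqrt_nonneg _)
  have hnorm : ‖s‖ ≤ (n + 2) * |s.im| := by
    refine (Complex.norm_le_abs_re_add_abs_im s).trans ?_
    rw [abs_of_nonneg (by linarith)]
    nlinarith [(n.cast_nonneg : (0 : ℝ) ≤ n)]
  have hpow : ‖s‖ ^ (s.re - 1 / 2) ≤ (n + 2) ^ n * |s.im| ^ (s.re - 1 / 2) := by
    calc ‖s‖ ^ (s.re - 1 / 2) ≤ ((n + 2) * |s.im|) ^ (s.re - 1 / 2) :=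
          Real.rpow_le_rpow (norm_nonneg _) hnorm (by linarith)
      _ = (n + 2) ^ (s.re - 1 / 2) * |s.im| ^ (s.re - 1 / 2) :=
          Real.mul_rpow (by positivity) (abs_nonneg _)
      _ ≤ (n + 2) ^ (n : ℝ) * |s.im| ^ (s.re - 1 / 2) := by
          refine mul_le_mul_of_nonneg_right ?_ (by positivity)
          refine Real.rpow_le_rpow_of_exponent_le ?_ (by linarith)
          linarith [(n.cast_nonneg : (0 : ℝ) ≤ n)]
      _ = _ := by rw [Real.rpow_natCast]
  have hexp : Real.exp (-(s.arg * s.im)) ≤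
      Real.exp (n + 1 / 2) * Real.exp (-(Real.pi / 2 * |s.im|)) := by
    rw [← Real.exp_add]
    refine Real.exp_le_exp.2 ?_
    linarith [Complex.le_arg_mul_im (s := s) (by linarith)]
  calc ‖s‖ ^ (s.re - 1 / 2) / Real.exp (s.arg * s.im)
      = ‖s‖ ^ (s.re - 1 / 2) * Real.exp (-(s.arg * s.im)) := by rw [Real.exp_neg, div_eq_mul_inv]
    _ ≤ ((n + 2) ^ n * |s.im| ^ (s.re - 1 / 2)) *
        (Real.exp (n + 1 / 2) * Real.exp (-(Real.pi / 2 * |s.im|))) := by gcongr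
    _ = _ := by ring

/-- Lower half of Stirling's estimate for `Γ` on vertical strips. -/
theorem Complex.exists_le_norm_Gamma (n : ℕ) : ∃ c : ℝ, 0 < c ∧ ∀ s : ℂ, 1 / 2 ≤ s.re →
    s.re ≤ n + 1 / 2 → 1 ≤ |s.im| →
    c * (|s.im| ^ (s.re - 1 / 2) * Real.exp (-(Real.pi / 2 * |s.im|))) ≤ ‖Complex.Gamma s‖ := by
  obtain ⟨C, hC, hupper⟩ := Complex.exists_norm_Gamma_le n
  refine ⟨Real.pi / C, div_pos Real.pi_pos hC, fun s h1 h2 h3 => ?_⟩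
  have ht : 0 < |s.im| := by linarith
  have him : s.im ≠ 0 := abs_pos.1 ht
  have hw := hupper (1 - s + n) (by simp; linarith) (by simp; linarith) (by simpa using h3)
  have hwim : |(1 - s + n).im| = |s.im| := by simp
  have hwre : (1 - s + n).re - 1 / 2 = n - (s.re - 1 / 2) := by simp; ring
  rw [hwim, hwre, Complex.Gamma_add_natCast n (fun k _ h0 => him (by
    simpa using congrArg Complex.im h0)), norm_mul, norm_prod] at hw
  have hprod : |s.im| ^ n ≤ ∏ k ∈ range n, ‖1 - s + k‖ := by
    calc |s.im| ^ n = ∏ k ∈ range n, |s.im| := by simp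
      _ ≤ _ := by
        refine Finset.prod_le_prod (fun _ _ => abs_nonneg _) fun k _ => ?_
        simpa using Complex.abs_im_le_norm (1 - s + k)
  have hsin : ‖Complex.sin (Real.pi * s)‖ ≤ Real.exp (Real.pi * |s.im|) := by
    rw [← Complex.cos_pi_div_two_sub]
    refine (Complex.norm_cos_le _).trans (le_of_eq ?_)
    congr 1
    have : (Real.pi / 2 - Real.pi * s : ℂ).im = -(Real.pi * s.im) := by
      have : ((Real.pi : ℂ) / 2).im = 0 := by
        rw [show (Real.pi : ℂ) / 2 = ((Real.pi / 2 : ℝ) : ℂ) by push_cast; rfl, Complex.ofReal_im]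
      rw [Complex.sub_im, this, Complex.im_ofReal_mul]; ring
    rw [this, abs_neg, abs_mul, abs_of_pos Real.pi_pos]
  have hrefl := Complex.Gamma_mul_Gamma_one_sub s
  have hne : Complex.sin (Real.pi * s) ≠ 0 := by
    intro h0
    obtain ⟨k, hk⟩ := Complex.sin_eq_zero_iff.1 h0
    rw [mul_comm] at hk
    have := mul_right_cancel₀ (by exact_mod_cast Real.pi_ne_zero) hk
    exact him (by simp [this])
  have hrefl' : Real.pi ≤ ‖Complex.Gamma s‖ * ‖Complex.Gamma (1 - s)‖ *
      Real.exp (Real.pi * |s.im|) := by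
    rw [← norm_mul, hrefl, norm_div, Complex.norm_real, Real.norm_of_nonneg Real.pi_pos.le,
      div_mul_eq_mul_div, le_div_iff₀ (norm_pos_iff.2 hne)]
    exact mul_le_mul_of_nonneg_left hsin Real.pi_pos.le
  rw [Real.rpow_sub ht, Real.rpow_natCast] at hw
  have hG : ‖Complex.Gamma (1 - s)‖ ≤
      C * (Real.exp (-(Real.pi / 2 * |s.im|)) / |s.im| ^ (s.re - 1 / 2)) := by
    refine le_of_mul_le_mul_left (le_trans (mul_le_mul_of_nonneg_right hprod (norm_nonneg _))
      (hw.trans (le_of_eq ?_))) (pow_pos ht n)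
    ring
  have hT : 0 < |s.im| ^ (s.re - 1 / 2) := Real.rpow_pos_of_pos ht _
  have hE : Real.exp (Real.pi * |s.im|) =
      (Real.exp (-(Real.pi / 2 * |s.im|)) * Real.exp (-(Real.pi / 2 * |s.im|)))⁻¹ := by
    rw [← Real.exp_add, ← Real.exp_neg]; congr 1; ring
  set E := Real.exp (-(Real.pi / 2 * |s.im|)) with hEdef
  have hEpos : 0 < E := Real.exp_pos _
  have hfin : Real.pi ≤ ‖Complex.Gamma s‖ * (C * (E / |s.im| ^ (s.re - 1 / 2))) * (E * E)⁻¹ := by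
    rw [← hE]
    exact hrefl'.trans (by gcongr)
  have : ‖Complex.Gamma s‖ * (C * (E / |s.im| ^ (s.re - 1 / 2))) * (E * E)⁻¹ =
      ‖Complex.Gamma s‖ * (C / (|s.im| ^ (s.re - 1 / 2) * E)) := by field_simp
  rw [this, ← div_le_iff₀ (by positivity)] at hfin
  refine le_trans (le_of_eq ?_) hfin
  field_simp

/-- On `Re s ≥ x > 1`, both `ζ` and `1 / ζ` are bounded by `∑ n ^ (-x)`. -/
theorem exists_norm_riemannZeta_bounds_of_one_lt {x : ℝ} (hx : 1 < x) :
    ∃ K : ℝ, 0 < K ∧ ∀ s : ℂ, x ≤ s.re → ‖riemannZeta s‖ ≤ K ∧ K⁻¹ ≤ ‖riemannZeta s‖ := by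
  have hbound : ∀ f : ℕ → ℂ, (∀ n, ‖f n‖ ≤ 1) → ∀ s : ℂ, x ≤ s.re →
      ‖LSeries f s‖ ≤ ∑' n : ℕ, ‖LSeries.term 1 (x : ℂ) n‖ := by
    intro f hf s hs
    have hsum : Summable fun n => ‖LSeries.term 1 (x : ℂ) n‖ :=
      (LSeriesSummable_one_iff.2 (by simpa using hx)).norm
    refine tsum_of_norm_bounded hsum.hasSum fun n => ?_
    refine (LSeries.norm_term_le_of_re_le_re (s := (x : ℂ)) f (by simpa using hs) n).trans ?_
    exact LSeries.norm_term_le (x : ℂ) (by simpa using hf n)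
  set K := ∑' n : ℕ, ‖LSeries.term 1 (x : ℂ) n‖ with hK
  have hz : ∀ s : ℂ, x ≤ s.re → ‖riemannZeta s‖ ≤ K := fun s hs => by
    rw [← LSeries_one_eq_riemannZeta (hx.trans_le hs)]
    exact hbound 1 (fun n => by simp) s hs
  have hpos : 0 < K := by
    refine lt_of_lt_of_le (norm_pos_iff.2 ?_) (hz x (by simp))
    exact riemannZeta_ne_zero_of_one_lt_re (by simpa using hx)
  refine ⟨K, hpos, fun s hs => ⟨hz s hs, ?_⟩⟩
  have h1 := LSeries_one_mul_Lseries_moebius (hx.trans_le hs)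
  rw [LSeries_one_eq_riemannZeta (hx.trans_le hs)] at h1
  have h2 := congrArg norm h1
  rw [norm_mul, norm_one] at h2
  have h3 := hbound (fun n => (ArithmeticFunction.moebius n : ℂ)) (fun n => by
    rw [Complex.norm_intCast]
    exact_mod_cast ArithmeticFunction.abs_moebius_le_one) s hs
  rw [inv_le_iff_one_le_mul₀ hpos, ← h2]
  exact mul_le_mul_of_nonneg_left h3 (norm_nonneg _)

/-- The growth of `ζ` in vertical strips of the left half plane. -/
theorem exists_norm_riemannZeta_bounds_of_neg {x y : ℝ} (hy : y < 0) :
    ∃ c C : ℝ, 0 < c ∧ 0 < C ∧ ∀ s : ℂ, x ≤ s.re → s.re ≤ y → 1 ≤ |s.im| →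
      c * |s.im| ^ (1 / 2 - s.re) ≤ ‖riemannZeta s‖ ∧
      ‖riemannZeta s‖ ≤ C * |s.im| ^ (1 / 2 - s.re) := by
  obtain ⟨n, hn⟩ := exists_nat_ge (1 - x)
  obtain ⟨C, hC, hupper⟩ := Complex.exists_norm_Gamma_le n
  obtain ⟨c, hc, hlower⟩ := Complex.exists_le_norm_Gamma n
  obtain ⟨K, hK, hzeta⟩ := exists_norm_riemannZeta_bounds_of_one_lt (x := 1 - y) (by linarith)
  have hpi := Real.pi_gt_three
  refine ⟨2 * ((2 * Real.pi) ^ (-(n : ℝ))) * c * (1 / 4) * K⁻¹, 2 * 1 * C * 1 * K,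
    by positivity, by positivity, fun s h1 h2 h3 => ?_⟩
  set w := 1 - s with hw
  have hwre : w.re = 1 - s.re := by simp [hw]
  have hwim : |w.im| = |s.im| := by simp [hw]
  have hwim0 : w.im ≠ 0 := abs_pos.1 (by rw [hwim]; linarith)
  have hfe := riemannZeta_one_sub (s := w) (fun m h0 => hwim0 (by simp [h0]))
    (fun h0 => hwim0 (by simp [h0]))
  have hsw : 1 - w = s := by simp [hw]
  have hcosim : |((Real.pi : ℂ) * w / 2).im| = Real.pi / 2 * |s.im| := by
    have : ((Real.pi : ℂ) * w / 2).im = Real.pi / 2 * w.im := by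
      rw [show (Real.pi : ℂ) * w / 2 = ((Real.pi / 2 : ℝ) : ℂ) * w by push_cast; ring,
        Complex.im_ofReal_mul]
    rw [this, abs_mul, hwim, abs_of_pos (by positivity)]
  have hcos1 := Complex.norm_cos_le ((Real.pi : ℂ) * w / 2)
  have hcos2 := Complex.exp_abs_im_le_norm_cos (z := (Real.pi : ℂ) * w / 2)
    (by rw [hcosim]; nlinarith)
  rw [hcosim] at hcos1 hcos2
  have hG1 := hupper w (by linarith) (by linarith) (by rwa [hwim])
  have hG2 := hlower w (by linarith) (by linarith) (by rwa [hwim])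
  have hexpo : w.re - 1 / 2 = 1 / 2 - s.re := by rw [hwre]; ring
  rw [hwim, hexpo] at hG1 hG2
  obtain ⟨hz1, hz2⟩ := hzeta w (by linarith)
  have hp : ‖(2 * Real.pi : ℂ) ^ (-w)‖ = (2 * Real.pi) ^ (-w.re) := by
    rw [show (2 * Real.pi : ℂ) = ((2 * Real.pi : ℝ) : ℂ) by push_cast; rfl,
      Complex.norm_cpow_eq_rpow_re_of_pos (by positivity), Complex.neg_re]
  have hp1 : ‖(2 * Real.pi : ℂ) ^ (-w)‖ ≤ 1 := by
    rw [hp]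
    exact Real.rpow_le_one_of_one_le_of_nonpos (by linarith) (by linarith)
  have hp2 : (2 * Real.pi) ^ (-(n : ℝ)) ≤ ‖(2 * Real.pi : ℂ) ^ (-w)‖ := by
    rw [hp]
    exact Real.rpow_le_rpow_of_exponent_le (by linarith) (by linarith)
  rw [hsw] at hfe
  rw [hfe, norm_mul, norm_mul, norm_mul, norm_mul, Complex.norm_ofNat]
  have hEE : Real.exp (-(Real.pi / 2 * |s.im|)) * Real.exp (Real.pi / 2 * |s.im|) = 1 := by
    rw [← Real.exp_add, neg_add_cancel, Real.exp_zero]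
  set T := |s.im| ^ (1 / 2 - s.re)
  have hT : 0 ≤ T := by positivity
  constructor
  · calc 2 * ((2 * Real.pi) ^ (-(n : ℝ))) * c * (1 / 4) * K⁻¹ * T
        = 2 * ((2 * Real.pi) ^ (-(n : ℝ))) * c * (1 / 4) * K⁻¹ * T *
          (Real.exp (-(Real.pi / 2 * |s.im|)) * Real.exp (Real.pi / 2 * |s.im|)) := by
          rw [hEE, mul_one]
      _ = 2 * ((2 * Real.pi) ^ (-(n : ℝ))) * (c * (T * Real.exp (-(Real.pi / 2 * |s.im|)))) *
          (Real.exp (Real.pi / 2 * |s.im|) / 4) * K⁻¹ := by ring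
      _ ≤ _ := by gcongr
  · calc _ ≤ 2 * 1 * (C * (T * Real.exp (-(Real.pi / 2 * |s.im|)))) *
          Real.exp (Real.pi / 2 * |s.im|) * K := by gcongr
      _ = 2 * 1 * C * 1 * K * T *
          (Real.exp (-(Real.pi / 2 * |s.im|)) * Real.exp (Real.pi / 2 * |s.im|)) := by ring
      _ = _ := by rw [hEE, mul_one]

/-- The filter of `s` in the strip `x ≤ Re s ≤ y` with `|Im s| → ∞`. -/
def verticalStripAtTop (x y : ℝ) : Filter ℂ :=
  comap (fun s => |s.im|) atTop ⊓ 𝓟 {s | x ≤ s.re ∧ s.re ≤ y}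

theorem tendsto_abs_im_verticalStripAtTop (x y : ℝ) :
    Tendsto (fun s : ℂ => |s.im|) (verticalStripAtTop x y) atTop :=
  tendsto_comap.mono_left inf_le_left

theorem eventually_verticalStripAtTop_mem (x y : ℝ) :
    ∀ᶠ s in verticalStripAtTop x y, x ≤ s.re ∧ s.re ≤ y :=
  mem_inf_of_right (mem_principal_self _)

theorem riemannZeta_mul_isTheta {b x y : ℝ} (hb : 0 < b) (hy : y < 0) :
    (fun s : ℂ => riemannZeta (b * s)) =Θ[verticalStripAtTop x y]
      fun s => |s.im| ^ (1 / 2 - b * s.re) := by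
  obtain ⟨c, C, hc, hC, h⟩ := exists_norm_riemannZeta_bounds_of_neg (x := b * x)
    (y := b * y) (mul_neg_of_pos_of_neg hb hy)
  set M := |Real.log b| * (1 / 2 - b * x)
  have key : ∀ᶠ s in verticalStripAtTop x y,
      c * (Real.exp (-M) * |s.im| ^ (1 / 2 - b * s.re)) ≤ ‖riemannZeta (b * s)‖ ∧
      ‖riemannZeta (b * s)‖ ≤ C * (Real.exp M * |s.im| ^ (1 / 2 - b * s.re)) := by
    filter_upwards [eventually_verticalStripAtTop_mem x y,
      (tendsto_abs_im_verticalStripAtTop x y).eventually_ge_atTop (1 / b)] with s hs ht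
    rw [div_le_iff₀' hb] at ht
    have hbs := h (b * s) (by rw [Complex.re_ofReal_mul]; gcongr; exact hs.1)
      (by rw [Complex.re_ofReal_mul]; gcongr; exact hs.2)
      (by rwa [Complex.im_ofReal_mul, abs_mul, abs_of_pos hb])
    rw [Complex.re_ofReal_mul, Complex.im_ofReal_mul, abs_mul, abs_of_pos hb,
      Real.mul_rpow hb.le (abs_nonneg _)] at hbs
    have he0 : 0 ≤ 1 / 2 - b * s.re := by nlinarith [hs.2]
    have he1 : 1 / 2 - b * s.re ≤ 1 / 2 - b * x := by nlinarith [hs.1]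
    have hlog : |Real.log b * (1 / 2 - b * s.re)| ≤ M := by
      rw [abs_mul, abs_of_nonneg he0]
      exact mul_le_mul_of_nonneg_left he1 (abs_nonneg _)
    rw [abs_le] at hlog
    have hb1 : Real.exp (-M) ≤ b ^ (1 / 2 - b * s.re) := by
      rw [Real.rpow_def_of_pos hb]; exact Real.exp_le_exp.2 hlog.1
    have hb2 : b ^ (1 / 2 - b * s.re) ≤ Real.exp M := by
      rw [Real.rpow_def_of_pos hb]; exact Real.exp_le_exp.2 hlog.2
    exact ⟨le_trans (by gcongr) hbs.1, hbs.2.trans (by gcongr)⟩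
  constructor
  · refine IsBigO.of_bound (C * Real.exp M) (key.mono fun s hs => ?_)
    rw [Real.norm_of_nonneg (by positivity), mul_assoc]
    exact hs.2
  · refine IsBigO.of_bound ((c * Real.exp (-M))⁻¹) (key.mono fun s hs => ?_)
    rw [Real.norm_of_nonneg (by positivity), inv_mul_eq_div, le_div_iff₀ (by positivity)]
    linarith [hs.1]

theorem prod_riemannZeta_mul_isTheta {ι : Type*} {P : Finset ι} {b : ι → ℝ} {x y : ℝ}
    (hb : ∀ p ∈ P, 0 < b p) (hy : y < 0) :
    (fun s : ℂ => ∏ p ∈ P, riemannZeta (b p * s)) =Θ[verticalStripAtTop x y]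
      fun s => |s.im| ^ ((P.card : ℝ) / 2 - (∑ p ∈ P, b p) * s.re) := by
  refine (IsTheta.finsetProd fun p hp => riemannZeta_mul_isTheta (x := x) (hb p hp) hy).trans_eventuallyEq ?_
  filter_upwards [(tendsto_abs_im_verticalStripAtTop x y).eventually_gt_atTop 0] with s hs
  rw [← Real.rpow_sum_of_pos hs, Finset.sum_sub_distrib, Finset.sum_const, nsmul_eq_mul,
    ← Finset.sum_mul]
  congr 1; ring

theorem rpow_abs_im_isLittleO {u v : ℝ} (huv : u < v) (A x y : ℝ) :
    (fun s : ℂ => |s.im| ^ (u - A * s.re)) =o[verticalStripAtTop x y]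
      fun s => |s.im| ^ (v - A * s.re) := by
  have h0 : Tendsto (fun s : ℂ => |s.im| ^ (-(v - u))) (verticalStripAtTop x y) (nhds 0) :=
    (tendsto_rpow_neg_atTop (by linarith)).comp (tendsto_abs_im_verticalStripAtTop x y)
  have h1 := ((isLittleO_one_iff ℝ).2 h0).mul_isBigO
    (isBigO_refl (fun s : ℂ => |s.im| ^ (v - A * s.re)) (verticalStripAtTop x y))
  simp only [one_mul] at h1
  refine h1.congr' ?_ EventuallyEq.rfl
  filter_upwards [(tendsto_abs_im_verticalStripAtTop x y).eventually_gt_atTop 0] with s hs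
  rw [← Real.rpow_add hs]
  congr 1; ring

section SetPartitions

variable {ι : Type*} [Fintype ι] [DecidableEq ι] {P : Finset (Finset ι)}

theorem sum_sum_of_sup_eq_univ {M : Type*} [AddCommMonoid M] (hsup : P.sup id = Finset.univ)
    (hdisj : ∀ p ∈ P, ∀ q ∈ P, p ≠ q → Disjoint p q) (f : ι → M) :
    ∑ p ∈ P, ∑ j ∈ p, f j = ∑ j, f j := by
  rw [← hsup, Finset.sup_eq_biUnion]
  exact (Finset.sum_biUnion (t := id) fun p hp q hq h => hdisj p hp q hq h).symm

theorem card_lt_of_ne_image_singleton (hempty : (∅ : Finset ι) ∉ P)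
    (hsup : P.sup id = Finset.univ) (hdisj : ∀ p ∈ P, ∀ q ∈ P, p ≠ q → Disjoint p q)
    (hP : P ≠ Finset.univ.image singleton) : P.card < Fintype.card ι := by
  have hcard : ∑ p ∈ P, p.card = Fintype.card ι := by
    have := sum_sum_of_sup_eq_univ hsup hdisj fun _ => 1
    simpa using this
  have hone : ∀ p ∈ P, 1 ≤ p.card := fun p hp =>
    Finset.card_pos.2 (Finset.nonempty_iff_ne_empty.2 fun h => hempty (h ▸ hp))
  by_contra hlt
  have hall : ∀ p ∈ P, 1 = p.card := by
    refine (Finset.sum_eq_sum_iff_of_le hone).1 ?_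
    have := Finset.sum_le_sum hone
    simp only [Finset.sum_const, smul_eq_mul, mul_one] at this ⊢
    omega
  refine hP (Finset.ext fun p => ?_)
  simp only [Finset.mem_image, Finset.mem_univ, true_and]
  constructor
  · intro hp
    obtain ⟨j, hj⟩ := Finset.card_eq_one.1 (hall p hp).symm
    exact ⟨j, hj.symm⟩
  · rintro ⟨j, rfl⟩
    have hj : j ∈ P.sup id := hsup ▸ Finset.mem_univ j
    obtain ⟨p, hp, hjp⟩ := Finset.mem_sup.1 hj
    obtain ⟨k, rfl⟩ := Finset.card_eq_one.1 (hall p hp).symm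
    rwa [Finset.mem_singleton.1 hjp]

end SetPartitions

/-- In vertical strips of the left half plane, the partition into singletons dominates `ζ̃`. -/
theorem tzeta_isTheta {r : ℕ} {a : Fin r → ℝ} (hpos : ∀ j, 0 < a j) {x y : ℝ} (hy : y < 0) :
    tzeta a =Θ[verticalStripAtTop x y] fun s => |s.im| ^ ((r : ℝ) / 2 - (∑ j, a j) * s.re) := by
  classical
  set S := (Finset.univ : Finset (Finset (Fin r))).powerset.filter
      (fun P => (∅ : Finset (Fin r)) ∉ P ∧ P.sup id = Finset.univ ∧
        ∀ p ∈ P, ∀ q ∈ P, p ≠ q → Disjoint p q) with hS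
  set F : Finset (Finset (Fin r)) → ℂ → ℂ := fun P s => (-1 : ℂ) ^ (r - P.card) *
      ∏ p ∈ P, (((p.card - 1).factorial : ℂ) *
        riemannZeta ((∑ j ∈ p, (a j : ℂ)) * s)) with hF
  have hterm : ∀ P ∈ S, F P =Θ[verticalStripAtTop x y]
      fun s => |s.im| ^ ((P.card : ℝ) / 2 - (∑ j, a j) * s.re) := by
    intro P hP
    obtain ⟨-, hempty, hsup, hdisj⟩ := Finset.mem_filter.1 hP
    have h := prod_riemannZeta_mul_isTheta (P := P) (b := fun p => ∑ j ∈ p, a j) (x := x)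
      (fun p hp => Finset.sum_pos (fun j _ => hpos j)
        (Finset.nonempty_iff_ne_empty.2 fun h => hempty (h ▸ hp))) hy
    rw [sum_sum_of_sup_eq_univ hsup hdisj] at h
    have hconst : (-1 : ℂ) ^ (r - P.card) * ∏ p ∈ P, ((p.card - 1).factorial : ℂ) ≠ 0 :=
      mul_ne_zero (pow_ne_zero _ (by norm_num))
        (Finset.prod_ne_zero_iff.2 fun p _ => Nat.cast_ne_zero.2 (Nat.factorial_ne_zero _))
    have heq : F P = fun s => ((-1 : ℂ) ^ (r - P.card) * ∏ p ∈ P, ((p.card - 1).factorial : ℂ)) *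
        ∏ p ∈ P, riemannZeta (((∑ j ∈ p, a j : ℝ) : ℂ) * s) := by
      funext s
      simp only [hF, Finset.prod_mul_distrib, Complex.ofReal_sum, mul_assoc]
    rw [heq]
    exact (isTheta_const_mul_left hconst).2 h
  set P₀ : Finset (Finset (Fin r)) := Finset.univ.image singleton with hP₀
  have hcard : P₀.card = r := by
    rw [hP₀, Finset.card_image_of_injective _ Finset.singleton_injective, Finset.card_fin]
  have hmem : P₀ ∈ S := by
    refine Finset.mem_filter.2 ⟨Finset.mem_powerset.2 (Finset.subset_univ _), ?_, ?_, ?_⟩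
    · simp [hP₀]
    · refine Finset.eq_univ_of_forall fun j => Finset.mem_sup.2 ⟨{j}, ?_, ?_⟩ <;> simp [hP₀]
    · simp only [hP₀, Finset.mem_image, Finset.mem_univ, true_and]
      rintro _ ⟨j, rfl⟩ _ ⟨k, rfl⟩ hjk
      exact Finset.disjoint_singleton.2 fun h => hjk (h ▸ rfl)
  have hsplit : tzeta a = F P₀ + fun s => ∑ P ∈ S.erase P₀, F P s := by
    funext s
    exact (Finset.add_sum_erase S (fun P => F P s) hmem).symm
  have hmain := hterm P₀ hmem
  rw [hcard] at hmain
  rw [hsplit]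
  refine hmain.add_isLittleO (IsLittleO.fun_sum fun P hP => ?_)
  obtain ⟨hne, hPS⟩ := Finset.mem_erase.1 hP
  obtain ⟨-, hempty, hsup, hdisj⟩ := Finset.mem_filter.1 hPS
  have hlt : (P.card : ℝ) < r := by
    exact_mod_cast (card_lt_of_ne_image_singleton hempty hsup hdisj hne).trans_eq (Fintype.card_fin r)
  exact (hterm P hPS).trans_isLittleO (rpow_abs_im_isLittleO (by linarith) _ _ _)

/-- For every `a` and `y₁ > y₂ > 0` there is `C₃ > 0` such that `ζ̃(s) ≠ a` whenever
`-y₁ ≤ Re s ≤ -y₂` and `|Im s| > C₃`. -/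
theorem a_point_free_vertical_strip {r : ℕ} (hr : 2 ≤ r) (a : Fin r → ℝ)
    (ha : Antitone a) (hpos : ∀ j, 0 < a j) (aa : ℂ) (y₁ y₂ : ℝ)
    (hy₂ : 0 < y₂) (hy : y₂ < y₁) :
    ∃ C₃ : ℝ, 0 < C₃ ∧ ∀ s : ℂ, -y₁ ≤ s.re → s.re ≤ -y₂ → C₃ < |s.im| →
      tzeta a s ≠ aa := by
  have hθ := tzeta_isTheta hpos (x := -y₁) (y := -y₂) (by linarith)
  have hr' : (1 : ℝ) ≤ (r : ℝ) / 2 := by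
    have : (2 : ℝ) ≤ r := by exact_mod_cast hr
    linarith
  have hA : 0 ≤ ∑ j, a j := Finset.sum_nonneg fun j _ => (hpos j).le
  have htop : Tendsto (fun s => ‖tzeta a s‖) (verticalStripAtTop (-y₁) (-y₂)) atTop := by
    refine hθ.tendsto_norm_atTop_iff.2 ?_
    refine tendsto_atTop_mono' _ ?_ (tendsto_abs_im_verticalStripAtTop (-y₁) (-y₂))
    filter_upwards [eventually_verticalStripAtTop_mem (-y₁) (-y₂),
      (tendsto_abs_im_verticalStripAtTop (-y₁) (-y₂)).eventually_ge_atTop 1] with s hs ht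
    simp only [Function.comp_apply]
    rw [Real.norm_of_nonneg (by positivity)]
    calc |s.im| = |s.im| ^ (1 : ℝ) := (Real.rpow_one _).symm
      _ ≤ _ := Real.rpow_le_rpow_of_exponent_le ht (by nlinarith [hs.2])
  have hev := htop.eventually_gt_atTop ‖aa‖
  rw [verticalStripAtTop, eventually_inf_principal, eventually_comap] at hev
  obtain ⟨T, hT⟩ := eventually_atTop.1 hev
  refine ⟨max T 1, by positivity, fun s h1 h2 h3 heq => ?_⟩
  have := hT |s.im| ((le_max_left _ _).trans h3.le) s rfl ⟨h1, h2⟩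
  rw [heq] at this
  exact lt_irrefl _ this
end

section
/- Let b > 0, y > 0 and fix t₀ > 0. Then, as T → ∞, the imaginary part of the contour integral of ζ'(bs)/ζ(bs) along the vertical segment from −y + iT down to −y + it₀ (i.e. Im ∫_{−y+iT}^{−y+it₀} ζ'(bs)/ζ(bs) ds) equals T·log(bT/(2π)) − T + O(log T). (Note that ζ(bs) has no zeros on this segment, since b(−y+it) has negative real part and nonzero imaginary part for t > 0.) -/
open Finset Filter Asymptotics

theorem exists_primitive_logDeriv_riemannZeta :
    ∃ P : ℂ → ℂ, (∀ w : ℂ, 1 < w.re → HasDerivAt P (logDeriv riemannZeta w) w) ∧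
      ∀ c : ℝ, 1 < c → ∃ C, ∀ w : ℂ, w.re = c → ‖P w‖ ≤ C := by
  set f : ℕ → ℂ := fun n ↦ ArithmeticFunction.vonMangoldt n / Complex.log n with hf
  have hlogMul : LSeries.logMul f = fun n ↦ (ArithmeticFunction.vonMangoldt n : ℂ) := by
    funext n
    rcases Nat.lt_or_ge 1 n with hn | hn
    · have : Complex.log n ≠ 0 := by
        rw [← Complex.natCast_log]
        exact_mod_cast (Real.log_pos (by exact_mod_cast hn)).ne'
      simp only [LSeries.logMul, hf]
      field_simp
    · interval_cases n <;> simp [LSeries.logMul]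
  have habs : LSeries.abscissaOfAbsConv f ≤ 1 := by
    rw [← LSeries.abscissaOfAbsConv_logMul, hlogMul]
    refine LSeries.abscissaOfAbsConv_le_of_forall_lt_LSeriesSummable fun y hy ↦ ?_
    exact ArithmeticFunction.LSeriesSummable_vonMangoldt (by simpa using hy)
  have hlt {w : ℂ} (hw : 1 < w.re) : LSeries.abscissaOfAbsConv f < w.re :=
    habs.trans_lt (by exact_mod_cast hw)
  refine ⟨LSeries f, fun w hw ↦ ?_, fun c hc ↦ ⟨∑' n, ‖LSeries.term f c n‖, fun w hw ↦ ?_⟩⟩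
  · have := LSeries_hasDerivAt (hlt hw)
    rw [hlogMul, ArithmeticFunction.LSeries_vonMangoldt_eq_deriv_riemannZeta_div hw] at this
    simpa [logDeriv_apply, neg_div] using this
  · have hsum : Summable fun n ↦ ‖LSeries.term f c n‖ :=
      (LSeriesSummable_of_abscissaOfAbsConv_lt_re (hlt (w := c) (by simpa using hc))).norm
    refine tsum_of_norm_bounded hsum.hasSum fun n ↦ ?_
    exact LSeries.norm_term_le_of_re_le_re f (by simp [hw]) n

theorem abs_re_tan_le {z : ℂ} (hz : z.im ≠ 0) : |(Complex.tan z).re| ≤ 1 / z.im ^ 2 := by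
  have hs : z.im ^ 2 ≤ Real.sinh z.im ^ 2 := by
    rw [sq_le_sq]
    rcases le_total 0 z.im with h | h
    · rw [abs_of_nonneg h, abs_of_nonneg (Real.sinh_nonneg_iff.2 h)]
      exact Real.self_le_sinh_iff.2 h
    · rw [abs_of_nonpos h, abs_of_nonpos (Real.sinh_nonpos_iff.2 h)]
      exact neg_le_neg (Real.sinh_le_self_iff.2 h)
  have hpos : 0 < z.im ^ 2 := by positivity
  have hcos : Complex.normSq (Complex.cos z) = Real.cos z.re ^ 2 + Real.sinh z.im ^ 2 := by
    rw [Complex.cos_eq, Complex.normSq_apply]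
    simp [Complex.cos_ofReal_re, Complex.sin_ofReal_re, Complex.sinh_ofReal_re]
    have h1 := Real.cosh_sq z.im
    have h2 := Real.sin_sq_add_cos_sq z.re
    linear_combination Real.cos z.re ^ 2 * h1 + Real.sinh z.im ^ 2 * h2
  have hre : (Complex.tan z).re =
      Real.sin z.re * Real.cos z.re / (Real.cos z.re ^ 2 + Real.sinh z.im ^ 2) := by
    rw [Complex.tan, Complex.div_re, hcos, ← add_div, Complex.cos_eq, Complex.sin_eq]
    congr 1
    simp [Complex.cos_ofReal_re, Complex.sin_ofReal_re, Complex.sinh_ofReal_re]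
    have h1 := Real.cosh_sq z.im
    linear_combination Real.sin z.re * Real.cos z.re * h1
  rw [hre, abs_div, abs_mul, abs_of_nonneg (by positivity :
    0 ≤ Real.cos z.re ^ 2 + Real.sinh z.im ^ 2)]
  gcongr
  · exact mul_le_one₀ (Real.abs_sin_le_one _) (abs_nonneg _) (Real.abs_cos_le_one _)
  · nlinarith [sq_nonneg (Real.cos z.re)]

theorem norm_log_sub_inv_add_le (k : ℕ) {z : ℂ} (hz : 0 < z.re) :
    ‖(Real.log ((k + 2) / (k + 1)) : ℂ) - (z + (k + 1))⁻¹‖ ≤ (1 + ‖z‖) * (1 / ((k : ℝ) + 1) ^ 2) := by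
  have hk : (0 : ℝ) < k + 1 := by positivity
  have hle : (k : ℝ) + 1 ≤ ‖z + (k + 1)‖ := by
    refine le_trans ?_ (Complex.re_le_norm _)
    simp
    linarith
  have hne : z + (k + 1) ≠ 0 := norm_pos_iff.1 (hk.trans_le hle)
  have hkc : (k : ℂ) + 1 ≠ 0 := by exact_mod_cast hk.ne'
  have h1 : |Real.log ((k + 2) / (k + 1)) - ((k : ℝ) + 1)⁻¹| ≤ 1 / ((k : ℝ) + 1) ^ 2 := by
    have hq : (0 : ℝ) < (k + 2) / (k + 1) := by positivity
    have hu := Real.log_le_sub_one_of_pos hq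
    have hl := Real.one_sub_inv_le_log_of_pos hq
    have e1 : ((k : ℝ) + 2) / (k + 1) - 1 = ((k : ℝ) + 1)⁻¹ := by field_simp; ring
    have e2 : ((k : ℝ) + 1)⁻¹ - 1 / ((k : ℝ) + 1) ^ 2 ≤ 1 - (((k : ℝ) + 2) / (k + 1))⁻¹ := by
      rw [← sub_nonneg]
      have : 1 - (((k : ℝ) + 2) / (k + 1))⁻¹ - (((k : ℝ) + 1)⁻¹ - 1 / ((k : ℝ) + 1) ^ 2) =
          1 / ((k + 2) * (k + 1) ^ 2) := by field_simp; ring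
      rw [this]
      positivity
    have : 0 ≤ 1 / ((k : ℝ) + 1) ^ 2 := by positivity
    rw [abs_le]
    constructor <;> linarith
  have h2 : ‖((k : ℂ) + 1)⁻¹ - (z + (k + 1))⁻¹‖ ≤ ‖z‖ * (1 / ((k : ℝ) + 1) ^ 2) := by
    have : ((k : ℂ) + 1)⁻¹ - (z + (k + 1))⁻¹ = z / (((k : ℂ) + 1) * (z + (k + 1))) := by
      field_simp; ring
    have hn : ‖(k : ℂ) + 1‖ = k + 1 := by
      exact_mod_cast Complex.norm_of_nonneg hk.le
    rw [this, norm_div, norm_mul, hn, mul_one_div, pow_two]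
    gcongr
  calc _ = ‖((Real.log ((k + 2) / (k + 1)) - ((k : ℝ) + 1)⁻¹ : ℝ) : ℂ) +
        (((k : ℂ) + 1)⁻¹ - (z + (k + 1))⁻¹)‖ := by push_cast; ring_nf
    _ ≤ _ := (norm_add_le _ _).trans (by
      rw [Complex.norm_real, Real.norm_eq_abs, add_mul, one_mul]
      exact add_le_add h1 h2)

theorem summable_one_div_nat_add_one_sq : Summable fun k : ℕ ↦ 1 / ((k : ℝ) + 1) ^ 2 := by
  simpa using (summable_nat_add_iff 1).2 (Real.summable_one_div_nat_pow.2 one_lt_two)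

theorem summable_log_sub_inv_add {z : ℂ} (hz : 0 < z.re) :
    Summable fun k : ℕ ↦ (Real.log ((k + 2) / (k + 1)) : ℂ) - (z + (k + 1))⁻¹ :=
  .of_norm_bounded (summable_one_div_nat_add_one_sq.mul_left (1 + ‖z‖)) fun k ↦ norm_log_sub_inv_add_le k hz

theorem exp_sum_log_sub_log_eq (n : ℕ) {z : ℂ} (hz : 0 < z.re) :
    Complex.exp (∑ k ∈ range n, (z * Real.log ((k + 2) / (k + 1)) - Complex.log (1 + z / (k + 1)))) =
      ((n : ℂ) + 1) ^ z * n.factorial / ∏ k ∈ range n, (z + (k + 1)) := by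
  induction n with
  | zero => simp
  | succ n ih =>
    have hk : (0 : ℝ) < n + 1 := by positivity
    have hk2 : (0 : ℝ) < n + 2 := by positivity
    have hkc : (n : ℂ) + 1 ≠ 0 := by exact_mod_cast hk.ne'
    have hkc2 : (n : ℂ) + 1 + 1 ≠ 0 := by
      have := hk2.ne'
      rw [add_assoc, one_add_one_eq_two]
      exact_mod_cast this
    have hne : z + (n + 1) ≠ 0 := fun h ↦ by
      have := congrArg Complex.re h
      simp at this
      linarith
    have h1 : 1 + z / (n + 1) = (z + (n + 1)) / (n + 1) := by field_simp; ring
    have h0 : 1 + z / ((n : ℂ) + 1) ≠ 0 := by rw [h1]; exact div_ne_zero hne hkc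
    have h2 : Complex.log (n + 1 + 1) = Complex.log (n + 1) + Real.log ((n + 2) / (n + 1)) := by
      have e1 : (n : ℂ) + 1 + 1 = ((n + 2 : ℝ) : ℂ) := by push_cast; ring
      have e2 : (n : ℂ) + 1 = ((n + 1 : ℝ) : ℂ) := by push_cast; ring
      rw [e1, e2, ← Complex.ofReal_log hk2.le, ← Complex.ofReal_log hk.le,
        Real.log_div hk2.ne' hk.ne']
      push_cast; ring
    rw [sum_range_succ, Complex.exp_add, ih, Complex.exp_sub, Complex.exp_log h0, prod_range_succ,
      Nat.factorial_succ, Complex.cpow_def_of_ne_zero hkc]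
    push_cast
    rw [Complex.cpow_def_of_ne_zero hkc2, h2, add_mul, Complex.exp_add, h1]
    rw [mul_comm z (Real.log _ : ℂ)]
    field_simp

theorem tendsto_cpow_mul_factorial_div_prod {z : ℂ} (hz : 0 < z.re) :
    Tendsto (fun n : ℕ ↦ ((n : ℂ) + 1) ^ z * n.factorial / ∏ k ∈ range n, (z + (k + 1))) atTop
      (nhds (Complex.Gamma (z + 1))) := by
  have hz0 : z ≠ 0 := fun h ↦ by simp [h] at hz
  have hlim : Tendsto (fun n : ℕ ↦ (((n : ℂ) + 1) / n) ^ z) atTop (nhds 1) := by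
    have h1 : Tendsto (fun n : ℕ ↦ ((n : ℂ) + 1) / n) atTop (nhds 1) := by
      have := (tendsto_natCast_div_add_atTop (1 : ℂ)).inv₀ one_ne_zero
      simpa using this
    simpa using h1.cpow tendsto_const_nhds (by simp)
  have := (hlim.mul (Complex.GammaSeq_tendsto_Gamma z)).const_mul z
  rw [one_mul, ← Complex.Gamma_add_one z hz0] at this
  refine this.congr' ?_
  filter_upwards [eventually_gt_atTop 0] with n hn
  have hnc : (n : ℂ) ≠ 0 := by exact_mod_cast hn.ne'
  have hpow : ((n : ℂ) + 1) ^ z = (((n : ℂ) + 1) / n) ^ z * (n : ℂ) ^ z := by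
    have e : ((n : ℂ) + 1) / n = (((n + 1) / n : ℝ) : ℂ) := by push_cast; rfl
    have e' : (n : ℂ) = ((n : ℝ) : ℂ) := by simp
    rw [e, e', ← Complex.mul_cpow_ofReal_nonneg (by positivity) (by positivity)]
    congr 1
    push_cast
    field_simp
  rw [Complex.GammaSeq, prod_range_succ', hpow]
  push_cast
  rw [add_zero, mul_comm (∏ k ∈ range n, (z + ((k : ℂ) + 1))) z]
  field_simp

theorem hasSum_digamma_add_one {z : ℂ} (hz : 0 < z.re) :
    HasSum (fun k : ℕ ↦ (Real.log ((k + 2) / (k + 1)) : ℂ) - (z + (k + 1))⁻¹)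
      (Complex.digamma (z + 1)) := by
  set g : ℕ → ℂ → ℂ := fun k w ↦ w * Real.log ((k + 2) / (k + 1)) - Complex.log (1 + w / (k + 1))
  set g' : ℕ → ℂ → ℂ := fun k w ↦ (Real.log ((k + 2) / (k + 1)) : ℂ) - (w + (k + 1))⁻¹
  have hderiv : ∀ k w, 0 < w.re → HasDerivAt (g k) (g' k w) w := fun k w hw ↦ by
    have hkc : (k : ℂ) + 1 ≠ 0 := by exact_mod_cast k.succ_ne_zero
    have hre : 0 < (1 + w / (k + 1)).re := by
      have : w / ((k : ℂ) + 1) = w / ((k + 1 : ℝ) : ℂ) := by push_cast; rfl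
      rw [Complex.add_re, this, Complex.div_ofReal_re, Complex.one_re]
      positivity
    have h := (((hasDerivAt_id w).div_const ((k : ℂ) + 1)).const_add 1).clog (.inl hre)
    refine (((hasDerivAt_id w).mul_const _).sub h).congr_deriv ?_
    have : w + (k + 1) ≠ 0 := fun h0 ↦ by
      have := congrArg Complex.re h0
      simp at this
      have : (0 : ℝ) ≤ k := k.cast_nonneg
      linarith
    have e : 1 + w / (k + 1) = (w + (k + 1)) / ((k : ℂ) + 1) := by field_simp; ring
    simp only [g', id, one_mul]
    rw [e]
    field_simp
  set t : Set ℂ := {w | 0 < w.re} ∩ Metric.ball 0 (‖z‖ + 2)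
  have ht : IsOpen t := (isOpen_lt continuous_const Complex.continuous_re).inter Metric.isOpen_ball
  have htc : IsPreconnected t :=
    ((convex_halfSpace_re_gt 0).inter (convex_ball _ _)).isPreconnected
  have hone : (1 : ℂ) ∈ t := by
    refine ⟨by simp, ?_⟩
    simp
    linarith [norm_nonneg z]
  have hzt : z ∈ t := ⟨hz, by simp⟩
  have hu : Summable fun k : ℕ ↦ (1 + (‖z‖ + 2)) * (1 / ((k : ℝ) + 1) ^ 2) :=
    summable_one_div_nat_add_one_sq.mul_left _
  have hg' : ∀ k, ∀ w ∈ t, ‖g' k w‖ ≤ (1 + (‖z‖ + 2)) * (1 / ((k : ℝ) + 1) ^ 2) :=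
    fun k w hw ↦ (norm_log_sub_inv_add_le k hw.1).trans (by
      have : ‖w‖ < ‖z‖ + 2 := by simpa using hw.2
      gcongr)
  have hg1 : Summable fun k ↦ g k 1 := by
    refine summable_zero.congr fun k ↦ ?_
    have hkc : (k : ℂ) + 1 ≠ 0 := by exact_mod_cast k.succ_ne_zero
    have : 1 + 1 / ((k : ℂ) + 1) = (((k + 2) / (k + 1) : ℝ) : ℂ) := by
      push_cast; field_simp; ring
    simp only [g]
    rw [this, ← Complex.ofReal_log (by positivity)]
    simp
  have hA : ∀ w ∈ t, HasDerivAt (fun w ↦ ∑' k, g k w) (∑' k, g' k w) w := fun w hw ↦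
    hasDerivAt_tsum_of_isPreconnected hu ht htc (fun k v hv ↦ hderiv k v hv.1) hg' hone hg1 hw
  have hAs : ∀ w ∈ t, Summable fun k ↦ g k w := fun w hw ↦
    summable_of_summable_hasDerivAt_of_isPreconnected hu ht htc (fun k v hv ↦ hderiv k v hv.1)
      hg' hone hg1 hw
  have hexp : ∀ w ∈ t, Complex.exp (∑' k, g k w) = Complex.Gamma (w + 1) := fun w hw ↦ by
    refine tendsto_nhds_unique ?_ (tendsto_cpow_mul_factorial_div_prod hw.1)
    refine ((Complex.continuous_exp.tendsto _).comp (hAs w hw).hasSum.tendsto_sum_nat).congr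
      fun n ↦ exp_sum_log_sub_log_eq n hw.1
  have hd : HasDerivAt (fun w ↦ Complex.Gamma (w + 1))
      (Complex.exp (∑' k, g k z) * ∑' k, g' k z) z :=
    (hA z hzt).cexp.congr_of_eventuallyEq
      (Filter.eventuallyEq_of_mem (ht.mem_nhds hzt) fun w hw ↦ (hexp w hw).symm)
  have hval : Complex.digamma (z + 1) = ∑' k, g' k z := by
    rw [Complex.digamma_def, logDeriv_apply, ← deriv_comp_add_const, hd.deriv, ← hexp z hzt,
      mul_div_cancel_left₀ _ (Complex.exp_ne_zero _)]
  rw [hval]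
  exact (summable_log_sub_inv_add hz).hasSum

theorem abs_log_norm_add_one_sub_le {w : ℂ} (hw : 1 ≤ w.re) :
    |Real.log ‖w + 1‖ - Real.log ‖w‖ - (w⁻¹).re| ≤ 5 / ‖w‖ ^ 2 := by
  have hre := Complex.re_le_norm w
  have hpos : 0 < ‖w‖ := by linarith
  set N := ‖w‖ ^ 2 with hN
  have hN0 : 0 < N := by positivity
  have hN1 : w.re ^ 2 ≤ N := by rw [hN]; gcongr
  have hNs : Complex.normSq w = N := Complex.normSq_eq_norm_sq w
  have hsq : ‖w + 1‖ ^ 2 = N + (2 * w.re + 1) := by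
    rw [← Complex.normSq_eq_norm_sq, ← hNs, Complex.normSq_apply, Complex.normSq_apply]
    simp
    ring
  set x := (2 * w.re + 1) / N with hx
  have hx0 : 0 ≤ x := by positivity
  have hlog : Real.log ‖w + 1‖ - Real.log ‖w‖ = Real.log (1 + x) / 2 := by
    have e : 1 + x = ‖w + 1‖ ^ 2 / N := by rw [hsq, hx]; field_simp
    have h1 : ‖w + 1‖ ≠ 0 := by
      intro h
      rw [h] at hsq
      nlinarith
    rw [e, Real.log_div (by positivity) hN0.ne', hN, Real.log_pow, Real.log_pow]
    push_cast
    ring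
  have hinv : (w⁻¹).re = w.re / N := by rw [Complex.inv_re, hNs]
  have hu : Real.log (1 + x) ≤ x := by
    have := Real.log_le_sub_one_of_pos (show 0 < 1 + x by linarith)
    linarith
  have hl : x - x ^ 2 ≤ Real.log (1 + x) := by
    refine le_trans ?_ (Real.one_sub_inv_le_log_of_pos (show 0 < 1 + x by linarith))
    rw [← sub_nonneg]
    have : 1 - (1 + x)⁻¹ - (x - x ^ 2) = x ^ 3 / (1 + x) := by
      field_simp
      ring
    rw [this]
    positivity
  have hxx : x ^ 2 ≤ 9 / N := by
    rw [hx, div_pow, div_le_div_iff₀ (by positivity) hN0]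
    have : (2 * w.re + 1) ^ 2 ≤ 9 * N := by nlinarith
    nlinarith
  have hsplit : x / 2 = w.re / N + 1 / 2 / N := by rw [hx]; field_simp
  have h5 : 5 / N = 9 / N / 2 + 1 / 2 / N := by field_simp; norm_num
  have : 0 < 1 / 2 / N := by positivity
  have : 0 < 9 / N := by positivity
  rw [hlog, hinv, abs_le]
  constructor <;> linarith

theorem abs_log_norm_add_nat_sub_sum_le {w : ℂ} (hw : 1 ≤ w.re) (him : w.im ≠ 0) (n : ℕ) :
    |Real.log ‖w + n‖ - Real.log ‖w‖ - ∑ k ∈ range n, ((w + k)⁻¹).re| ≤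
      10 / |w.im| - 10 / (|w.im| + n) := by
  have hv : 0 < |w.im| := abs_pos.2 him
  induction n with
  | zero => simp
  | succ n ih =>
    have hn : (0 : ℝ) ≤ n := n.cast_nonneg
    have hre : (w + n).re = w.re + n := by simp
    have himn : (w + n).im = w.im := by simp
    have h := abs_log_norm_add_one_sub_le (w := w + n) (by rw [hre]; linarith)
    have hnorm : (|w.im| + n) * (|w.im| + (n + 1)) / 2 ≤ ‖w + n‖ ^ 2 := by
      rw [← Complex.normSq_eq_norm_sq, Complex.normSq_apply, hre, himn, ← abs_mul_abs_self w.im]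
      nlinarith [sq_nonneg (w.re + n - |w.im|)]
    have hstep : 5 / ‖w + n‖ ^ 2 ≤ 10 / (|w.im| + n) - 10 / (|w.im| + (n + 1)) := by
      have : 10 / (|w.im| + n) - 10 / (|w.im| + (n + 1)) =
          5 / ((|w.im| + n) * (|w.im| + (n + 1)) / 2) := by field_simp; ring
      rw [this]
      gcongr
    rw [sum_range_succ]
    push_cast
    rw [← add_assoc w]
    have := abs_add_le (Real.log ‖w + n‖ - Real.log ‖w‖ - ∑ k ∈ range n, ((w + k)⁻¹).re)
      (Real.log ‖w + n + 1‖ - Real.log ‖w + n‖ - ((w + n)⁻¹).re)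
    refine le_trans (le_of_eq ?_) (this.trans ((add_le_add ih (h.trans hstep)).trans_eq ?_))
    · congr 1
      ring
    · ring

theorem tendsto_log_norm_add_nat_sub_log (w : ℂ) :
    Tendsto (fun n : ℕ ↦ Real.log ‖w + n‖ - Real.log (n + 1)) atTop (nhds 0) := by
  have h1 : Tendsto (fun n : ℕ ↦ 1 + (w - 1) / ((n : ℂ) + 1)) atTop (nhds 1) := by
    have h := (tendsto_one_div_add_atTop_nhds_zero_nat (𝕜 := ℂ)).const_mul (w - 1)
    simpa [div_eq_mul_inv] using h.const_add 1
  have h2 : Tendsto (fun n : ℕ ↦ Real.log ‖1 + (w - 1) / ((n : ℂ) + 1)‖) atTop (nhds 0) := by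
    have := h1.norm.log (by simp)
    simpa using this
  refine h2.congr' ?_
  filter_upwards [h1.eventually_ne one_ne_zero] with n hn
  have hk : (0 : ℝ) < n + 1 := by positivity
  have hkc : (n : ℂ) + 1 ≠ 0 := by exact_mod_cast hk.ne'
  have e : 1 + (w - 1) / ((n : ℂ) + 1) = (w + n) / (n + 1) := by field_simp; ring
  have hnorm : ‖(n : ℂ) + 1‖ = n + 1 := by exact_mod_cast Complex.norm_of_nonneg hk.le
  have hwn : w + n ≠ 0 := fun h ↦ hn (by rw [e, h, zero_div])
  rw [e, norm_div, hnorm, Real.log_div (norm_ne_zero_iff.2 hwn) hk.ne']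

/-- The first-order Stirling approximation of the real part of the digamma function. -/
theorem abs_re_digamma_sub_log_norm_le {w : ℂ} (hw : 1 < w.re) (him : w.im ≠ 0) :
    |(Complex.digamma w).re - Real.log ‖w‖| ≤ 10 / |w.im| := by
  have hv : 0 < |w.im| := abs_pos.2 him
  have hs := Complex.hasSum_re (hasSum_digamma_add_one (z := w - 1) (by simpa using hw))
  rw [sub_add_cancel] at hs
  have hlim := ((tendsto_log_norm_add_nat_sub_log w).add hs.tendsto_sum_nat).sub_const
    (Real.log ‖w‖)
  rw [zero_add] at hlim
  refine le_of_tendsto hlim.abs (Eventually.of_forall fun n ↦ ?_)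
  have htel : ∑ k ∈ range n, Real.log (((k : ℝ) + 2) / (k + 1)) = Real.log (n + 1) := by
    induction n with
    | zero => simp
    | succ n ih =>
      rw [sum_range_succ, ih, Real.log_div (by positivity) (by positivity)]
      push_cast
      rw [add_sub_cancel, add_assoc, one_add_one_eq_two]
  have hsum : ∑ k ∈ range n, ((Real.log ((k + 2) / (k + 1)) : ℂ) - (w - 1 + (k + 1))⁻¹).re =
      Real.log (n + 1) - ∑ k ∈ range n, ((w + k)⁻¹).re := by
    rw [← htel, ← sum_sub_distrib]
    refine sum_congr rfl fun k _ ↦ ?_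
    rw [Complex.sub_re, Complex.ofReal_re, sub_add_add_cancel]
  rw [hsum]
  have h := abs_log_norm_add_nat_sub_sum_le hw.le him n
  have : 0 ≤ 10 / (|w.im| + n) := by positivity
  refine le_trans (le_of_eq ?_) (h.trans (sub_le_self _ this))
  congr 1
  ring

theorem cos_pi_mul_div_two_ne_zero {w : ℂ} (him : w.im ≠ 0) :
    Complex.cos (Real.pi * w / 2) ≠ 0 := by
  rw [Complex.cos_ne_zero_iff]
  intro k hk
  have e : ((2 * k + 1) * Real.pi / 2 : ℂ) = (((2 * k + 1) * Real.pi / 2 : ℝ) : ℂ) := by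
    push_cast; rfl
  have e' : (Real.pi * w / 2 : ℂ) = ((Real.pi / 2 : ℝ) : ℂ) * w := by push_cast; ring
  have := congrArg Complex.im hk
  rw [e, e', Complex.im_ofReal_mul, Complex.ofReal_im] at this
  exact mul_ne_zero (by positivity) him this

theorem ne_neg_natCast_of_im_ne_zero {w : ℂ} (him : w.im ≠ 0) (n : ℕ) : w ≠ -n :=
  fun h ↦ him (by simp [h])

theorem ne_one_of_im_ne_zero {w : ℂ} (him : w.im ≠ 0) : w ≠ 1 := fun h ↦ him (by simp [h])

theorem riemannZeta_one_sub_ne_zero {w : ℂ} (hw : 1 < w.re) (him : w.im ≠ 0) :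
    riemannZeta (1 - w) ≠ 0 := by
  rw [riemannZeta_one_sub (ne_neg_natCast_of_im_ne_zero him) (ne_one_of_im_ne_zero him)]
  have h2pi : (2 * Real.pi : ℂ) ≠ 0 := by simp
  refine mul_ne_zero (mul_ne_zero (mul_ne_zero (mul_ne_zero two_ne_zero ?_) ?_) ?_) ?_
  · simp [Complex.cpow_eq_zero_iff]
  · exact Complex.Gamma_ne_zero (ne_neg_natCast_of_im_ne_zero him)
  · exact cos_pi_mul_div_two_ne_zero him
  · exact riemannZeta_ne_zero_of_one_lt_re hw

theorem logDeriv_riemannZeta_one_sub {w : ℂ} (hw : 1 < w.re) (him : w.im ≠ 0) :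
    -logDeriv riemannZeta (1 - w) = -Real.log (2 * Real.pi) + Complex.digamma w -
      Real.pi / 2 * Complex.tan (Real.pi * w / 2) + logDeriv riemannZeta w := by
  have h1 := ne_one_of_im_ne_zero him
  have hG := ne_neg_natCast_of_im_ne_zero him
  have h1w : 1 - w ≠ 1 := fun h ↦ him (by rw [sub_eq_self.1 h, Complex.zero_im])
  have h2pi : (2 * Real.pi : ℂ) ≠ 0 := by simp
  have hcos := cos_pi_mul_div_two_ne_zero him
  have hleft : -logDeriv riemannZeta (1 - w) = logDeriv (fun v ↦ riemannZeta (1 - v)) w := by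
    have := logDeriv_comp (f := riemannZeta) (g := fun v ↦ 1 - v) (x := w)
      (differentiableAt_riemannZeta h1w) (by fun_prop)
    rw [Function.comp_def] at this
    rw [this, deriv_const_sub]
    simp
  have hev : (fun v ↦ riemannZeta (1 - v)) =ᶠ[nhds w] fun v ↦
      2 * (2 * Real.pi : ℂ) ^ (-v) * Complex.Gamma v * Complex.cos (Real.pi * v / 2) *
        riemannZeta v := by
    filter_upwards [(isOpen_ne.preimage Complex.continuous_im).mem_nhds him] with v hv
    exact riemannZeta_one_sub (ne_neg_natCast_of_im_ne_zero hv) (ne_one_of_im_ne_zero hv)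
  have hpow : HasDerivAt (fun v ↦ 2 * (2 * Real.pi : ℂ) ^ (-v))
      (2 * ((2 * Real.pi : ℂ) ^ (-w) * Complex.log (2 * Real.pi) * -1)) w :=
    ((hasDerivAt_neg w).const_cpow (.inl h2pi)).const_mul 2
  have hdcos : HasDerivAt (fun v ↦ Complex.cos (Real.pi * v / 2))
      (-Complex.sin (Real.pi * w / 2) * (Real.pi * 1 / 2)) w :=
    (((hasDerivAt_id w).const_mul (Real.pi : ℂ)).div_const 2).ccos
  have hdG := Complex.differentiableAt_Gamma w hG
  have hpow0 : (2 * Real.pi : ℂ) ^ (-w) ≠ 0 := by simp [Complex.cpow_eq_zero_iff]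
  have hG0 := Complex.Gamma_ne_zero hG
  have hz0 := riemannZeta_ne_zero_of_one_lt_re hw
  have hA0 : 2 * (2 * Real.pi : ℂ) ^ (-w) ≠ 0 := mul_ne_zero two_ne_zero hpow0
  have hdA := hpow.differentiableAt.fun_mul hdG
  rw [hleft, logDeriv_apply, hev.deriv_eq, hev.eq_of_nhds, ← logDeriv_apply,
    logDeriv_mul (f := fun v ↦ 2 * (2 * Real.pi : ℂ) ^ (-v) * Complex.Gamma v *
      Complex.cos (Real.pi * v / 2)) (g := riemannZeta) w (mul_ne_zero (mul_ne_zero hA0 hG0) hcos) hz0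
      (hdA.fun_mul hdcos.differentiableAt) (differentiableAt_riemannZeta h1),
    logDeriv_mul (f := fun v ↦ 2 * (2 * Real.pi : ℂ) ^ (-v) * Complex.Gamma v)
      (g := fun v ↦ Complex.cos (Real.pi * v / 2)) w (mul_ne_zero hA0 hG0) hcos hdA
      hdcos.differentiableAt,
    logDeriv_mul (f := fun v ↦ 2 * (2 * Real.pi : ℂ) ^ (-v)) (g := Complex.Gamma) w hA0 hG0
      hpow.differentiableAt hdG, ← Complex.digamma_def,
    logDeriv_apply (fun v ↦ 2 * (2 * Real.pi : ℂ) ^ (-v)), hpow.deriv,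
    logDeriv_apply (fun v ↦ Complex.cos (Real.pi * v / 2)), hdcos.deriv, Complex.tan]
  have hlog : Complex.log (2 * Real.pi) = Real.log (2 * Real.pi) := by
    rw [Complex.ofReal_log (by positivity)]
    push_cast
    rfl
  rw [hlog]
  field_simp
  ring

theorem log_norm_sub_log_abs_im_le {w : ℂ} (him : w.im ≠ 0) :
    |Real.log ‖w‖ - Real.log (|w.im|)| ≤ |w.re| / |w.im| := by
  have hv : 0 < |w.im| := abs_pos.2 him
  have hle := Complex.abs_im_le_norm w
  have h0 : 0 < ‖w‖ := hv.trans_le hle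
  rw [← Real.log_div h0.ne' hv.ne', abs_of_nonneg (Real.log_nonneg ((one_le_div hv).2 hle))]
  refine (Real.log_le_sub_one_of_pos (by positivity)).trans ?_
  rw [div_sub_one hv.ne']
  gcongr
  linarith [Complex.norm_le_abs_re_add_abs_im w]

theorem abs_re_logDeriv_riemannZeta_one_sub_le {w : ℂ} (hw : 1 < w.re) (him : w.im ≠ 0) :
    |(-logDeriv riemannZeta (1 - w)).re - Real.log (|w.im| / (2 * Real.pi)) -
      (logDeriv riemannZeta w).re| ≤ (10 + w.re) / |w.im| + 1 / w.im ^ 2 := by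
  have hv : 0 < |w.im| := abs_pos.2 him
  have him' : (Real.pi * w / 2 : ℂ).im = Real.pi / 2 * w.im := by
    have e' : (Real.pi * w / 2 : ℂ) = ((Real.pi / 2 : ℝ) : ℂ) * w := by push_cast; ring
    rw [e', Complex.im_ofReal_mul]
  have htan := abs_re_tan_le (z := Real.pi * w / 2) (by rw [him']; positivity)
  rw [him'] at htan
  have htan' : |Real.pi / 2 * (Complex.tan (Real.pi * w / 2)).re| ≤ 1 / w.im ^ 2 := by
    rw [abs_mul, abs_of_pos (by positivity : 0 < Real.pi / 2)]
    refine (mul_le_mul_of_nonneg_left htan (by positivity)).trans ?_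
    have : Real.pi / 2 * (1 / (Real.pi / 2 * w.im) ^ 2) = 1 / (Real.pi / 2 * w.im ^ 2) := by
      field_simp
    rw [this]
    gcongr
    nlinarith [Real.pi_gt_three, sq_nonneg w.im]
  have hre : (Real.pi / 2 * Complex.tan (Real.pi * w / 2)).re =
      Real.pi / 2 * (Complex.tan (Real.pi * w / 2)).re := by
    have : (Real.pi / 2 : ℂ) = ((Real.pi / 2 : ℝ) : ℂ) := by push_cast; rfl
    rw [this, Complex.re_ofReal_mul]
  have h1 := abs_re_digamma_sub_log_norm_le hw him
  have h2 := log_norm_sub_log_abs_im_le him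
  rw [abs_of_pos (by linarith : 0 < w.re)] at h2
  rw [logDeriv_riemannZeta_one_sub hw him, Real.log_div hv.ne' (by positivity), add_div]
  simp only [Complex.add_re, Complex.sub_re, Complex.neg_re, Complex.ofReal_re, hre]
  rw [abs_le] at *
  constructor <;> linarith [h1.1, h1.2, h2.1, h2.2, htan'.1, htan'.2]

/-- `Im ∫_{−y+iT}^{−y+it₀} ζ'(bs)/ζ(bs) ds = T log(bT/(2π)) − T + O(log T)`, the integral being
along the vertical segment, parametrized as `−∫_{t₀}^{T} i ζ'(b(−y+it))/ζ(b(−y+it)) dt`. -/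
theorem im_integral_log_deriv_zeta (b y t₀ : ℝ) (hb : 0 < b) (hy : 0 < y) (ht₀ : 0 < t₀) :
    (fun T : ℝ =>
        (-(∫ t in t₀..T, Complex.I * deriv riemannZeta ((b : ℂ) * (-(y : ℂ) + t * Complex.I)) /
            riemannZeta ((b : ℂ) * (-(y : ℂ) + t * Complex.I)))).im -
          (T * Real.log (b * T / (2 * Real.pi)) - T))
      =O[atTop] Real.log := by
  obtain ⟨P, hP, hPb⟩ := exists_primitive_logDeriv_riemannZeta
  obtain ⟨C, hC⟩ := hPb (1 + b * y) (by nlinarith)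
  have hby : 0 < b * y := by positivity
  set w : ℝ → ℂ := fun t ↦ 1 - (b : ℂ) * (-(y : ℂ) + t * Complex.I) with hw
  have hwre : ∀ t, (w t).re = 1 + b * y := fun t ↦ by simp [hw]
  have hwim : ∀ t, (w t).im = -(b * t) := fun t ↦ by simp [hw]
  have hwre' : ∀ t, 1 < (w t).re := fun t ↦ by rw [hwre]; linarith
  have hwim' : ∀ t, 0 < t → (w t).im ≠ 0 := fun t ht ↦ by
    rw [hwim]
    exact neg_ne_zero.2 (by positivity)
  have hwd : ∀ t, HasDerivAt w (-((b : ℂ) * Complex.I)) t := fun t ↦ by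
    have h := ((((hasDerivAt_id t).ofReal_comp.mul_const Complex.I).const_add
      (-(y : ℂ))).const_mul (b : ℂ)).const_sub 1
    simpa using h
  have hwc : Continuous w := by fun_prop
  have hcont : ∀ v : ℂ, v ≠ 1 → riemannZeta v ≠ 0 → ContinuousAt (logDeriv riemannZeta) v :=
    fun v hv hv0 ↦ by
      have hA : AnalyticAt ℂ riemannZeta v := analyticOn_riemannZeta v hv
      exact (hA.deriv.div hA hv0).continuousAt
  set r : ℝ → ℝ := fun t ↦ (-logDeriv riemannZeta (1 - w t)).re with hr
  set q : ℝ → ℝ := fun t ↦ (logDeriv riemannZeta (w t)).re with hq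
  set ℓ : ℝ → ℝ := fun t ↦ Real.log (b * t / (2 * Real.pi)) with hℓ
  have hRc : ∀ t, 0 < t → ContinuousAt (fun t ↦ logDeriv riemannZeta (1 - w t)) t := fun t ht ↦ by
    have hne : 1 - w t ≠ 1 := fun h ↦ hwim' t ht (by rw [sub_eq_self.1 h, Complex.zero_im])
    exact ContinuousAt.comp (f := fun t ↦ 1 - w t) (g := logDeriv riemannZeta)
      (hcont _ hne (riemannZeta_one_sub_ne_zero (hwre' t) (hwim' t ht))) (by fun_prop)
  have hrc : ∀ t, 0 < t → ContinuousAt r t := fun t ht ↦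
    Complex.continuous_re.continuousAt.comp (hRc t ht).neg
  have hQc : Continuous fun t ↦ logDeriv riemannZeta (w t) :=
    continuous_iff_continuousAt.2 fun t ↦ ContinuousAt.comp (g := logDeriv riemannZeta)
      (hcont _ (fun h ↦ by have := hwre' t; rw [h] at this; simp at this)
        (riemannZeta_ne_zero_of_one_lt_re (hwre' t))) hwc.continuousAt
  have hqc : Continuous q := Complex.continuous_re.comp hQc
  have hℓd : ∀ t, 0 < t → HasDerivAt (fun t ↦ t * Real.log (b * t / (2 * Real.pi)) - t) (ℓ t) t :=
    fun t ht ↦ by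
      have h := ((hasDerivAt_id t).mul ((((hasDerivAt_id t).const_mul b).div_const
        (2 * Real.pi)).log (by positivity))).sub (hasDerivAt_id t)
      refine h.congr_deriv ?_
      simp only [hℓ, id]
      field_simp
      ring
  have hℓc : ∀ t, 0 < t → ContinuousAt ℓ t := fun t ht ↦
    ContinuousAt.log (by fun_prop) (by positivity)
  set F : ℝ → ℂ := fun t ↦ Complex.I / b * P (w t) with hF
  have hbc : (b : ℂ) ≠ 0 := by exact_mod_cast hb.ne'
  have hFd : ∀ t, HasDerivAt F (logDeriv riemannZeta (w t)) t := fun t ↦ by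
    refine ((((hP (w t) (hwre' t)).comp t (hwd t)).const_mul (Complex.I / b))).congr_deriv ?_
    field_simp
    rw [Complex.I_sq]
    ring
  have hFb : ∀ t, |(F t).re| ≤ C / b := fun t ↦ by
    refine (Complex.abs_re_le_norm _).trans ?_
    simp only [hF, norm_mul, norm_div, Complex.norm_I, Complex.norm_real, Real.norm_eq_abs,
      abs_of_pos hb]
    rw [one_div_mul_eq_div]
    gcongr
    exact hC _ (hwre t)
  set K : ℝ := (11 + b * y) / b + 1 / (b ^ 2 * t₀) with hK
  have hKpos : 0 < K := by positivity
  have herr : ∀ t, t₀ ≤ t → |r t - ℓ t - q t| ≤ K * t⁻¹ := fun t ht ↦ by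
    have ht0 : 0 < t := ht₀.trans_le ht
    have h := abs_re_logDeriv_riemannZeta_one_sub_le (hwre' t) (hwim' t ht0)
    rw [hwre, hwim, abs_neg, abs_of_pos (by positivity : 0 < b * t), neg_sq] at h
    refine h.trans ?_
    have h1 : (10 + (1 + b * y)) / (b * t) = (11 + b * y) / b * t⁻¹ := by field_simp; ring
    have h2 : 1 / (b * t) ^ 2 ≤ 1 / (b ^ 2 * t₀) * t⁻¹ := by
      rw [← div_eq_mul_inv, div_div, mul_pow, pow_two t, ← mul_assoc]
      gcongr
    rw [h1, hK, add_mul]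
    gcongr
  have hmain : ∀ T, t₀ ≤ T →
      |(∫ t in t₀..T, r t) - (T * Real.log (b * T / (2 * Real.pi)) - T)| ≤
        |t₀ * Real.log (b * t₀ / (2 * Real.pi)) - t₀| + 2 * (C / b) +
          K * (Real.log T - Real.log t₀) := fun T hT ↦ by
    have hT0 : 0 < T := ht₀.trans_le hT
    have hpos : ∀ t ∈ Set.uIcc t₀ T, 0 < t := fun t ht ↦ by
      rw [Set.uIcc_of_le hT] at ht
      exact ht₀.trans_le ht.1
    have hri : IntervalIntegrable r MeasureTheory.volume t₀ T :=
      ContinuousOn.intervalIntegrable fun t ht ↦ (hrc t (hpos t ht)).continuousWithinAt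
    have hℓi : IntervalIntegrable ℓ MeasureTheory.volume t₀ T :=
      ContinuousOn.intervalIntegrable fun t ht ↦ (hℓc t (hpos t ht)).continuousWithinAt
    have hqi : IntervalIntegrable q MeasureTheory.volume t₀ T := hqc.intervalIntegrable _ _
    have hinvi : IntervalIntegrable (fun t : ℝ ↦ K * t⁻¹) MeasureTheory.volume t₀ T :=
      ContinuousOn.intervalIntegrable fun t ht ↦
        ((continuousAt_inv₀ (hpos t ht).ne').const_mul K).continuousWithinAt
    have hℓint := intervalIntegral.integral_eq_sub_of_hasDerivAt
      (fun t ht ↦ hℓd t (hpos t ht)) hℓi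
    have hqint : ∫ t in t₀..T, q t = (F T).re - (F t₀).re :=
      intervalIntegral.integral_eq_sub_of_hasDerivAt
        (fun t _ ↦ Complex.reCLM.hasFDerivAt.comp_hasDerivAt t (hFd t)) hqi
    have hbound : |∫ t in t₀..T, (r t - ℓ t - q t)| ≤ K * (Real.log T - Real.log t₀) := by
      have h := intervalIntegral.norm_integral_le_of_norm_le hT
        (Eventually.of_forall fun t ht ↦ (Real.norm_eq_abs _).trans_le (herr t ht.1.le)) hinvi
      rwa [intervalIntegral.integral_const_mul, integral_inv_of_pos ht₀ hT0,
        Real.log_div hT0.ne' ht₀.ne', Real.norm_eq_abs] at h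
    rw [intervalIntegral.integral_sub (hri.sub hℓi) hqi, intervalIntegral.integral_sub hri hℓi,
      hℓint, hqint] at hbound
    have hF1 := hFb T
    have hF2 := hFb t₀
    have hb0 := neg_abs_le (t₀ * Real.log (b * t₀ / (2 * Real.pi)) - t₀)
    have hb1 := le_abs_self (t₀ * Real.log (b * t₀ / (2 * Real.pi)) - t₀)
    rw [abs_le] at hbound hF1 hF2 ⊢
    constructor <;> linarith [hbound.1, hbound.2, hF1.1, hF1.2, hF2.1, hF2.2]
  have him : ∀ T, t₀ ≤ T → (-(∫ t in t₀..T, Complex.I *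
      deriv riemannZeta ((b : ℂ) * (-(y : ℂ) + t * Complex.I)) /
        riemannZeta ((b : ℂ) * (-(y : ℂ) + t * Complex.I)))).im = ∫ t in t₀..T, r t :=
    fun T hT ↦ by
      have hpos : ∀ t ∈ Set.uIcc t₀ T, 0 < t := fun t ht ↦ by
        rw [Set.uIcc_of_le hT] at ht
        exact ht₀.trans_le ht.1
      have hi : IntervalIntegrable (fun t ↦ -(Complex.I * logDeriv riemannZeta (1 - w t)))
          MeasureTheory.volume t₀ T :=
        ContinuousOn.intervalIntegrable fun t ht ↦
          ((hRc t (hpos t ht)).const_mul Complex.I).neg.continuousWithinAt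
      have h := Complex.imCLM.intervalIntegral_comp_comm hi
      rw [← intervalIntegral.integral_neg]
      simp only [Complex.imCLM_apply] at h
      have e : ∀ t : ℝ, (b : ℂ) * (-(y : ℂ) + t * Complex.I) = 1 - w t := fun t ↦ by simp [hw]
      simp only [e, mul_div_assoc, ← logDeriv_apply]
      rw [← h]
      refine intervalIntegral.integral_congr fun t _ ↦ ?_
      simp [hr]
  set M : ℝ := |t₀ * Real.log (b * t₀ / (2 * Real.pi)) - t₀| + 2 * (C / b) + K * |Real.log t₀|
    with hM
  have hM0 : 0 ≤ M := by
    have : 0 ≤ C / b := (abs_nonneg _).trans (hFb t₀)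
    positivity
  refine IsBigO.of_bound (M + K) ?_
  filter_upwards [eventually_ge_atTop t₀, eventually_ge_atTop (Real.exp 1)] with T hT hTe
  have hlog : 1 ≤ Real.log T := by
    rw [Real.le_log_iff_exp_le ((Real.exp_pos 1).trans_le hTe)]
    exact hTe
  rw [him T hT, Real.norm_eq_abs, Real.norm_of_nonneg (by linarith)]
  have h1 : -Real.log t₀ ≤ |Real.log t₀| := neg_le_abs _
  nlinarith [hmain T hT, mul_le_mul_of_nonneg_left h1 hKpos.le,
    mul_le_mul_of_nonneg_left hlog hM0]
end
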